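/- arXiv:2210.06807 — 5 statements merged into one kernel-verified Lean document; each statement's English description precedes it below -/
import Mathlib

section
/- Let u, v, P, Q be positive reals with P > Q, let D(w) = P·exp(−u·w) − Q·exp(v·w), and let w₀ = ln(P/Q)/(u+v) > 0. Suppose w : [0,∞) → ℝ is differentiable with w(0) = 0 and w′(t) = A(t)·D(w(t)) for all t ≥ 0, where A : [0,∞) → ℝ is continuous and A(t) > 0 for all t. Then for every t ≥ 0 one has 0 ≤ w(t) < w₀, and w is strictly increasing on [0,∞). In particular, a trajectory initialized at 0 can never cross the stationary point w₀. -/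
open Real Set

/-- Let `w` solve `w' = A t * D w` on `[a, b]` with `A` continuous and `D` of class `C¹`. If `w`
ends at a zero `c` of `D`, then it also starts there. -/
theorem eq_equilibrium_left_of_eq_equilibrium_right {D w A : ℝ → ℝ} {a b c : ℝ} (hab : a ≤ b)
    (hD : ContDiff ℝ 1 D) (hc : D c = 0) (hA : ContinuousOn A (Icc a b))
    (hw : ∀ t ∈ Icc a b, HasDerivAt w (A t * D (w t)) t) (hb : w b = c) : w a = c := by
  have hcont : ContinuousOn w (Icc a b) := fun t ht => (hw t ht).continuousAt.continuousWithinAt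
  obtain ⟨R, hR⟩ := (isCompact_Icc.image_of_continuousOn hcont).isBounded.subset_closedBall 0
  obtain ⟨K, hK⟩ := hD.contDiffOn.exists_lipschitzOnWith one_ne_zero
    (convex_closedBall (0 : ℝ) R) (isCompact_closedBall 0 R)
  obtain ⟨M, hM⟩ := isCompact_Icc.exists_bound_of_continuousOn hA
  have hM0 : 0 ≤ M := (norm_nonneg _).trans (hM b (right_mem_Icc.2 hab))
  have hmem : ∀ t ∈ Icc a b, w t ∈ Metric.closedBall (0 : ℝ) R :=
    fun t ht => hR (mem_image_of_mem w ht)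
  have hlip : ∀ t ∈ Ioc a b,
      LipschitzOnWith (M.toNNReal * K) (fun x => A t * D x) (Metric.closedBall 0 R) := by
    intro t ht
    refine LipschitzOnWith.of_dist_le_mul fun x hx y hy => ?_
    rw [Real.dist_eq, ← mul_sub, abs_mul, NNReal.coe_mul, Real.coe_toNNReal _ hM0, mul_assoc]
    exact mul_le_mul (hM t (Ioc_subset_Icc_self ht)) (hK.dist_le_mul x hx y hy)
      (abs_nonneg _) hM0
  refine ODE_solution_unique_of_mem_Icc_left (g := fun _ => c) hlip hcont
    (fun t ht => (hw t (Ioc_subset_Icc_self ht)).hasDerivWithinAt)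
    (fun t ht => hmem t (Ioc_subset_Icc_self ht)) continuousOn_const (fun t _ => ?_)
    (fun _ _ => hb ▸ hmem b (right_mem_Icc.2 hab)) hb (left_mem_Icc.2 hab)
  simpa [hc] using hasDerivWithinAt_const t (Iic t) c

/-- With positive reals `u, v, P, Q`, `P > Q`, drift
`D w = P·exp(−u·w) − Q·exp(v·w)` and stationary point `w₀ = ln(P/Q)/(u+v) > 0`,
any trajectory `w` with `w 0 = 0` and `w′(t) = A(t)·D(w(t))` for a continuous
positive factor `A` on `[0,∞)` satisfies `0 ≤ w(t) < w₀` for all `t ≥ 0` and is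
strictly increasing on `[0,∞)`: it can never cross the stationary point `w₀`. -/
theorem trajectory_never_crosses_stationary_point
    (u v P Q : ℝ) (hu : 0 < u) (hv : 0 < v) (hP : 0 < P) (hQ : 0 < Q)
    (hPQ : Q < P) (D : ℝ → ℝ)
    (hD : ∀ x, D x = P * Real.exp (-u * x) - Q * Real.exp (v * x))
    (w₀ : ℝ) (hw₀ : w₀ = Real.log (P / Q) / (u + v))
    (w A : ℝ → ℝ) (hw0 : w 0 = 0)
    (hderiv : ∀ t ∈ Ici (0 : ℝ), HasDerivAt w (A t * D (w t)) t)
    (hAcont : ContinuousOn A (Ici (0 : ℝ)))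
    (hApos : ∀ t ∈ Ici (0 : ℝ), 0 < A t) :
    (∀ t ∈ Ici (0 : ℝ), 0 ≤ w t ∧ w t < w₀) ∧ StrictMonoOn w (Ici (0 : ℝ)) := by
  have huv : 0 < u + v := add_pos hu hv
  have hlog : (u + v) * w₀ = Real.log P - Real.log Q := by
    rw [hw₀, mul_div_cancel₀ _ huv.ne', Real.log_div hP.ne' hQ.ne']
  have hw₀pos : 0 < w₀ := by
    rw [hw₀]
    exact div_pos (Real.log_pos ((one_lt_div hQ).2 hPQ)) huv
  have hDexp : ∀ x, D x = Real.exp (Real.log P - u * x) - Real.exp (Real.log Q + v * x) := by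
    intro x
    rw [hD, sub_eq_add_neg (Real.log P), Real.exp_add, Real.exp_add, Real.exp_log hP,
      Real.exp_log hQ, neg_mul]
  have hDw₀ : D w₀ = 0 := by
    rw [hDexp, sub_eq_zero]
    congr 1
    linarith
  have hDpos : ∀ x < w₀, 0 < D x := by
    intro x hx
    rw [hDexp, sub_pos, Real.exp_lt_exp]
    nlinarith
  have hDsmooth : ContDiff ℝ 1 D := by
    rw [funext hD]
    fun_prop
  have hcont : ContinuousOn w (Ici 0) :=
    fun t ht => (hderiv t ht).continuousAt.continuousWithinAt
  have hne : ∀ t ∈ Ici (0 : ℝ), w t ≠ w₀ := by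
    intro t ht h
    have h0 := eq_equilibrium_left_of_eq_equilibrium_right ht hDsmooth hDw₀
      (hAcont.mono Icc_subset_Ici_self) (fun s hs => hderiv s hs.1) h
    exact hw₀pos.ne (hw0.symm.trans h0)
  have hlt : ∀ t ∈ Ici (0 : ℝ), w t < w₀ := by
    intro t ht
    by_contra! h
    obtain ⟨s, hs, hsw⟩ := isPreconnected_Ici.intermediate_value self_mem_Ici ht hcont
      ⟨hw0.trans_le hw₀pos.le, h⟩
    exact hne s hs hsw
  have hmono : StrictMonoOn w (Ici 0) := by
    refine strictMonoOn_of_deriv_pos (convex_Ici 0) hcont fun t ht => ?_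
    have ht' := interior_subset ht
    rw [(hderiv t ht').deriv]
    exact mul_pos (hApos t ht') (hDpos _ (hlt t ht'))
  exact ⟨fun t ht => ⟨hw0.symm.trans_le (hmono.monotoneOn self_mem_Ici ht ht), hlt t ht⟩, hmono⟩
end

section
/- Let u > 0, a > 1, and P > L > 0 be reals. Suppose w : [0,∞) → ℝ is differentiable with w(0) = 0, P − L·exp(u·w(t)) > 0 for all t ≥ 0, and w′(t) ≥ (1+t)^{−a} · (P·exp(−u·w(t)) − L) for all t ≥ 0. Then for every t ≥ 0: (1/(u·L)) · ln( (P − L)/(P − L·exp(u·w(t))) ) ≥ (1/(a−1)) · (1 − (1+t)^{1−a}). -/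
open Real Set

/-- Integrated form of the differential inequality: if
`u > 0`, `a > 1`, `P > L > 0`, and `w` is differentiable on `[0,∞)` with
`w 0 = 0`, `P − L·exp(u·w(t)) > 0`, and derivative at least
`(1+t)^(−a)·(P·exp(−u·w(t)) − L)` for all `t ≥ 0`, then for every `t ≥ 0`
`(1/(uL))·ln((P−L)/(P−L·exp(u·w(t)))) ≥ (1/(a−1))·(1 − (1+t)^(1−a))`. -/
theorem integrated_differential_inequality (u a P L : ℝ)
    (hu : 0 < u) (ha : 1 < a) (hL : 0 < L) (hPL : L < P)
    (w w' : ℝ → ℝ) (hw0 : w 0 = 0)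
    (hderiv : ∀ t ∈ Ici (0 : ℝ), HasDerivAt w (w' t) t)
    (hpos : ∀ t ∈ Ici (0 : ℝ), 0 < P - L * Real.exp (u * w t))
    (hineq : ∀ t ∈ Ici (0 : ℝ),
      (1 + t) ^ (-a) * (P * Real.exp (-u * w t) - L) ≤ w' t) :
    ∀ t ∈ Ici (0 : ℝ),
      (1 / (a - 1)) * (1 - (1 + t) ^ (1 - a)) ≤
        (1 / (u * L)) * Real.log ((P - L) / (P - L * Real.exp (u * w t))) := by
  intro t ht
  let F : ℝ → ℝ := fun s => (1 / (u * L)) * -Real.log (P - L * Real.exp (u * w s)) +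
    (1 / (a - 1)) * (1 + s) ^ (1 - a)
  have hF : ∀ s ∈ Ici (0 : ℝ), HasDerivAt F
      (Real.exp (u * w s) * w' s / (P - L * Real.exp (u * w s)) - (1 + s) ^ (-a)) s := by
    intro s hs
    have hs1 : 0 < 1 + s := add_pos_of_pos_of_nonneg one_pos hs
    have hD := (hpos s hs).ne'
    have hlog := ((((((hderiv s hs).const_mul u).exp).const_mul L).const_sub P).log hD).neg
    have hpow := ((hasDerivAt_id' s).const_add 1).rpow_const (p := 1 - a) (Or.inl hs1.ne')
    refine ((hlog.const_mul (1 / (u * L))).add (hpow.const_mul (1 / (a - 1)))).congr_deriv ?_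
    have ha' : a - 1 ≠ 0 := (sub_pos.2 ha).ne'
    rw [show 1 - a - 1 = -a by ring]
    field_simp
    ring
  have hmono : MonotoneOn F (Ici 0) := by
    refine monotoneOn_of_hasDerivWithinAt_nonneg (convex_Ici 0)
      (fun s hs => (hF s hs).continuousAt.continuousWithinAt)
      (fun s hs => (hF s (interior_subset hs)).hasDerivWithinAt) fun s hs => ?_
    replace hs := interior_subset hs
    rw [sub_nonneg, le_div_iff₀ (hpos s hs)]
    have hexp : Real.exp (u * w s) * Real.exp (-u * w s) = 1 := by
      rw [← Real.exp_add, neg_mul, add_neg_cancel, Real.exp_zero]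
    calc (1 + s) ^ (-a) * (P - L * Real.exp (u * w s))
        = Real.exp (u * w s) * ((1 + s) ^ (-a) * (P * Real.exp (-u * w s) - L)) := by
          linear_combination (-(1 + s) ^ (-a) * P) * hexp
      _ ≤ Real.exp (u * w s) * w' s :=
          mul_le_mul_of_nonneg_left (hineq s hs) (Real.exp_pos _).le
  have h := hmono self_mem_Ici ht ht
  simp only [F, hw0, mul_zero, Real.exp_zero, mul_one, add_zero, Real.one_rpow] at h
  rw [Real.log_div (sub_pos.2 hPL).ne' (hpos t ht).ne']
  linarith
end

section
/- (Deterministic core of Theorem 1.) Fix β > 0, y ∈ {−1,1}, δ ∈ ℝ with |δ| < β, p ∈ (1/2,1), and a > 1. Set u = β + δ·y, v = β − δ·y, P = p·u, Q = (1−p)·v, and assume P > Q. Set L = P^{v/(u+v)} · Q^{u/(u+v)} and K = 2(a−1). Suppose w : [0,∞) → ℝ is differentiable with w(0) = 0 and w′(t) = A(t)·(P·exp(−u·w(t)) − Q·exp(v·w(t))) for all t ≥ 0, where A : [0,∞) → ℝ is continuous and A(t) ≥ (1+t)^{−a} > 0 for all t. Then for every t ≥ 0 with (1+t)^{1−a}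 ≤ 1/2: exp(u·w(t)) ≥ (1 + u²·p/K)/(1 + u·L/K); equivalently, w(t) ≥ (1/u)·ln( (1 + u²·p/K)/(1 + u·L/K) ). -/
open Real Set

/-- If a function of the form `s ↦ (1 + P s) / (1 + L s)` is evaluated along a clock `s` with
derivative `σ`, its derivative is `σ (P - L) / (1 + L s) ^ 2`. -/
lemma hasDerivAt_moebius_comp {s : ℝ → ℝ} {σ x P L : ℝ} (hs : HasDerivAt s σ x)
    (h : 1 + L * s x ≠ 0) :
    HasDerivAt (fun t => (1 + P * s t) / (1 + L * s t))
      (σ * (P - L) / (1 + L * s x) ^ 2) x := by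
  have h1 : HasDerivAt (fun t => 1 + P * s t) (P * σ) x := (hs.const_mul P).const_add 1
  have h2 : HasDerivAt (fun t => 1 + L * s t) (L * σ) x := (hs.const_mul L).const_add 1
  refine (h1.div h2 h).congr_deriv ?_
  congr 1
  ring

/-- The antiderivative of `(1 + t) ^ (-a)` vanishing at `0`. -/
lemma hasDerivAt_one_add_rpow_clock {a x : ℝ} (ha : a ≠ 1) (hx : 0 ≤ x) :
    HasDerivAt (fun t : ℝ => (1 - (1 + t) ^ (1 - a)) / (a - 1)) ((1 + x) ^ (-a)) x := by
  have hx1 : (1 + x) ≠ 0 := by positivity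
  have h1 : HasDerivAt (fun t : ℝ => 1 + t) 1 x := (hasDerivAt_id x).const_add 1
  have h2 := ((h1.rpow_const (p := 1 - a) (Or.inl hx1)).const_sub 1).div_const (a - 1)
  refine h2.congr_deriv ?_
  have : a - 1 ≠ 0 := sub_ne_zero.mpr ha
  rw [show 1 - a - 1 = -a by ring]
  field_simp
  ring

/-- The common value of `P exp (-u w)` and `Q exp (v w)` at the point where they agree. -/
lemma exists_exp_balance {P Q u v : ℝ} (hP : 0 < P) (hQ : 0 < Q) (huv : u + v ≠ 0) :
    P ^ (v / (u + v)) * Q ^ (u / (u + v))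
      = P * exp (-u * ((log P - log Q) / (u + v))) ∧
    P ^ (v / (u + v)) * Q ^ (u / (u + v))
      = Q * exp (v * ((log P - log Q) / (u + v))) := by
  rw [rpow_def_of_pos hP, rpow_def_of_pos hQ, ← exp_add]
  constructor
  · refine Eq.trans ?_ (congrArg (· * _) (exp_log hP))
    rw [← exp_add]
    congr 1
    field_simp
    ring
  · refine Eq.trans ?_ (congrArg (· * _) (exp_log hQ))
    rw [← exp_add]
    congr 1
    field_simp
    ring

/-- Monotonicity of `s ↦ (1 + P s) / (1 + L s)` on the nonnegative reals when `L ≤ P`. -/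
lemma moebius_le_moebius {P L s r : ℝ} (hL : 0 < L) (hLP : L ≤ P) (hs : 0 ≤ s) (hsr : s ≤ r) :
    (1 + P * s) / (1 + L * s) ≤ (1 + P * r) / (1 + L * r) := by
  have hr : 0 ≤ r := hs.trans hsr
  rw [div_le_div_iff₀ (by positivity) (by positivity)]
  nlinarith [mul_nonneg (sub_nonneg.mpr hLP) (sub_nonneg.mpr hsr)]

/-- Lower barrier for the flow `w' = A (P exp (-u w) - Q exp (v w))` when `A` dominates the
derivative `σ` of a nonnegative clock `s`. Here `m` is the equilibrium and `L` the common value of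
the two terms of the drift there. -/
lemma moebius_le_exp_flow {P Q L u v m : ℝ} {w A s σ : ℝ → ℝ}
    (hu : 0 < u) (hv : 0 < v) (hP : 0 < P) (hQ : 0 < Q) (hLP : L < P)
    (hm₁ : L = P * exp (-u * m)) (hm₂ : L = Q * exp (v * m))
    (hw0 : w 0 = 0) (hs0 : s 0 = 0)
    (hw : ∀ t, 0 ≤ t → HasDerivAt w (A t * (P * exp (-u * w t) - Q * exp (v * w t))) t)
    (hs : ∀ t, 0 ≤ t → HasDerivAt s (σ t) t) (hs_nonneg : ∀ t, 0 ≤ t → 0 ≤ s t)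
    (hσ : ∀ t, 0 ≤ t → 0 < σ t) (hA : ∀ t, 0 ≤ t → σ t ≤ A t) {t : ℝ} (ht : 0 ≤ t) :
    (1 + u * P * s t) / (1 + u * L * s t) ≤ exp (u * w t) := by
  have hL : 0 < L := hm₂ ▸ by positivity
  have hden : ∀ x, 0 ≤ x → 0 < 1 + u * L * s x := fun x hx => by
    have := hs_nonneg x hx
    positivity
  have hc : ∀ x, 0 ≤ x → HasDerivAt (fun t => (1 + u * P * s t) / (1 + u * L * s t))
      (σ x * (u * P - u * L) / (1 + u * L * s x) ^ 2) x := fun x hx =>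
    hasDerivAt_moebius_comp (hs x hx) (hden x hx).ne'
  have hE : ∀ x, 0 ≤ x → HasDerivAt (fun t => exp (u * w t))
      (exp (u * w x) * (u * (A x * (P * exp (-u * w x) - Q * exp (v * w x))))) x :=
    fun x hx => ((hw x hx).const_mul u).exp
  refine image_le_of_deriv_right_lt_deriv_boundary' (a := 0) (b := t)
    (fun x hx => (hc x hx.1).continuousAt.continuousWithinAt)
    (fun x hx => (hc x hx.1).hasDerivWithinAt) (by simp [hw0, hs0])
    (fun x hx => (hE x hx.1).continuousAt.continuousWithinAt)
    (fun x hx => (hE x hx.1).hasDerivWithinAt) ?_ ⟨ht, le_rfl⟩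
  rintro x ⟨hx, -⟩ heq
  have hd := hden x hx
  have hcancel : exp (u * w x) * exp (-u * w x) = 1 := by
    rw [← exp_add]; simp
  have hgap : P - L * exp (u * w x) = (P - L) / (1 + u * L * s x) := by
    rw [div_eq_iff hd.ne'] at heq
    rw [eq_div_iff hd.ne']
    linear_combination L * heq
  have hgap_pos : 0 < P - L * exp (u * w x) := by
    rw [hgap]; exact div_pos (sub_pos.mpr hLP) hd
  have hwm : w x < m := by
    have h1 : exp (-u * m) * exp (u * w x) < 1 := by
      rw [hm₁] at hgap_pos
      by_contra! h
      nlinarith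
    rw [← exp_add, exp_lt_one_iff] at h1
    nlinarith
  have hQL : Q * exp (v * w x) < L := by
    rw [hm₂]; gcongr
  have hdrift : P - L * exp (u * w x) < P - exp (u * w x) * (Q * exp (v * w x)) := by
    nlinarith [exp_pos (u * w x)]
  calc σ x * (u * P - u * L) / (1 + u * L * s x) ^ 2
      = σ x * u * (P - L * exp (u * w x)) / (1 + u * L * s x) := by
        rw [hgap]; field_simp
    _ ≤ σ x * u * (P - L * exp (u * w x)) := by
        refine div_le_self (by have := hσ x hx; positivity) ?_
        have := hs_nonneg x hx
        have : 0 ≤ u * L * s x := by positivity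
        linarith
    _ < σ x * u * (P - exp (u * w x) * (Q * exp (v * w x))) := by
        have := hσ x hx
        gcongr
    _ ≤ A x * u * (P - exp (u * w x) * (Q * exp (v * w x))) := by
        have := hgap_pos.trans hdrift
        have := hA x hx
        gcongr
    _ = exp (u * w x) * (u * (A x * (P * exp (-u * w x) - Q * exp (v * w x)))) := by
        linear_combination (-(A x * u * P)) * hcancel

/-- deterministic core of Theorem 1. With `β > 0`,
`y ∈ {−1,1}`, `|δ| < β`, `p ∈ (1/2,1)`, `a > 1`, `u = β+δy`, `v = β−δy`,
`P = p·u > Q = (1−p)·v`, `L = P^(v/(u+v))·Q^(u/(u+v))`, `K = 2(a−1)`, if the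
spurious weight `w` satisfies `w 0 = 0` and the gradient-flow equation
`w′(t) = A(t)·(P·exp(−u·w(t)) − Q·exp(v·w(t)))` with `A` continuous on `[0,∞)`
and `A(t) ≥ (1+t)^(−a) > 0`, then for every `t ≥ 0` with `(1+t)^(1−a) ≤ 1/2`
one has `exp(u·w(t)) ≥ (1 + u²p/K)/(1 + uL/K)`, equivalently
`w(t) ≥ (1/u)·ln((1 + u²p/K)/(1 + uL/K))`. -/
theorem theorem1_deterministic_core (β δ y p a : ℝ)
    (hβ : 0 < β) (hy : y = 1 ∨ y = -1) (hδ : |δ| < β)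
    (hp : p ∈ Set.Ioo (1/2 : ℝ) 1) (ha : 1 < a)
    (u v P Q L K : ℝ)
    (hu : u = β + δ * y) (hv : v = β - δ * y)
    (hP : P = p * u) (hQ : Q = (1 - p) * v) (hPQ : Q < P)
    (hL : L = P ^ (v / (u + v)) * Q ^ (u / (u + v)))
    (hK : K = 2 * (a - 1))
    (w A : ℝ → ℝ) (hw0 : w 0 = 0)
    (hderiv : ∀ t ∈ Ici (0 : ℝ),
      HasDerivAt w (A t * (P * Real.exp (-u * w t) - Q * Real.exp (v * w t))) t)
    (hAcont : ContinuousOn A (Ici (0 : ℝ)))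
    (hA : ∀ t ∈ Ici (0 : ℝ), (1 + t) ^ (-a) ≤ A t) :
    ∀ t ∈ Ici (0 : ℝ), (1 + t) ^ (1 - a) ≤ 1/2 →
      (1 + u ^ 2 * p / K) / (1 + u * L / K) ≤ Real.exp (u * w t) ∧
      (1 / u) * Real.log ((1 + u ^ 2 * p / K) / (1 + u * L / K)) ≤ w t := by
  intro t ht ht_half
  rw [mem_Ici] at ht
  obtain ⟨hp₁, hp₂⟩ := hp
  obtain ⟨hδ₁, hδ₂⟩ := abs_lt.mp hδ
  have hu_pos : 0 < u := by rcases hy with rfl | rfl <;> linarith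
  have hv_pos : 0 < v := by rcases hy with rfl | rfl <;> linarith
  have hP_pos : 0 < P := hP ▸ mul_pos (by linarith) hu_pos
  have hQ_pos : 0 < Q := hQ ▸ mul_pos (by linarith) hv_pos
  have ha' : 0 < a - 1 := sub_pos.mpr ha
  obtain ⟨hm₁, hm₂⟩ := exists_exp_balance hP_pos hQ_pos (add_pos hu_pos hv_pos).ne'
  rw [← hL] at hm₁ hm₂
  have hL_pos : 0 < L := hm₂ ▸ by positivity
  have hLP : L < P := by
    have hm : 0 < (log P - log Q) / (u + v) :=
      div_pos (sub_pos.mpr (log_lt_log hQ_pos hPQ)) (by positivity)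
    rw [hm₁]
    refine mul_lt_of_lt_one_right hP_pos (exp_lt_one_iff.mpr ?_)
    nlinarith
  have hbarrier := moebius_le_exp_flow (s := fun t => (1 - (1 + t) ^ (1 - a)) / (a - 1))
    (σ := fun t => (1 + t) ^ (-a)) hu_pos hv_pos hP_pos hQ_pos hLP hm₁ hm₂ hw0 (by simp) hderiv
    (fun x hx => hasDerivAt_one_add_rpow_clock ha.ne' hx)
    (fun x hx => div_nonneg
      (sub_nonneg.mpr (rpow_le_one_of_one_le_of_nonpos (by linarith) (by linarith))) ha'.le)
    (fun x hx => rpow_pos_of_pos (by linarith) _) hA ht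
  have hclock : 1 / K ≤ (1 - (1 + t) ^ (1 - a)) / (a - 1) := by
    rw [hK, div_le_div_iff₀ (by positivity) ha']
    nlinarith
  have hK_pos : 0 < K := by rw [hK]; positivity
  have hbound : (1 + u ^ 2 * p / K) / (1 + u * L / K) ≤ exp (u * w t) := by
    refine le_trans (le_of_eq ?_) ((moebius_le_moebius (P := u * P) (L := u * L) (by positivity)
      (by gcongr) (by positivity) hclock).trans hbarrier)
    rw [hP]
    ring
  refine ⟨hbound, ?_⟩
  have hlhs_pos : 0 < (1 + u ^ 2 * p / K) / (1 + u * L / K) := by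
    have : 0 < p := by linarith
    positivity
  rw [one_div_mul_eq_div, div_le_iff₀' hu_pos]
  exact (log_le_iff_le_exp hlhs_pos).mpr hbound
end

section
/- (Theorem 1, paper's stated form, for nonnegative δ·y.) Under the hypotheses of the deterministic core of Theorem 1 (β > 0, y ∈ {−1,1}, |δ| < β, p ∈ (1/2,1), a > 1, u = β + δ·y, v = β − δ·y, P = p·u > Q = (1−p)·v, L = P^{v/(u+v)}·Q^{u/(u+v)}, K = 2(a−1), w differentiable with w(0)=0 and w′(t) = A(t)·(P·e^{−u·w(t)} − Q·e^{v·w(t)}) with A continuous and A(t) ≥ (1+t)^{−a} > 0), assume additionally δ·y ≥ 0. Set ε = δ·y/(2β), c₁ = K/(β+δy)², and c₂ = K/((β+δy)^{3/2−ε}·(β−δy)^{1/2+ε}). Then for every t ≥ 0 with (1+t)^{1−a} ≤ 1/2: w(t) ≥ (1/(β+δy)) · ln( (c₁ + p)/(c₂ + p^{1/2−ε}·(1−p)^{1/2+ε}) ). -/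
open Real Set

/-- A differentiable function on `[0, ∞)` that starts nonnegative and has nonnegative derivative
wherever it is negative stays nonnegative. -/
lemma nonneg_of_deriv_nonneg_of_neg {f f' : ℝ → ℝ}
    (hf : ∀ t ∈ Ici (0 : ℝ), HasDerivAt f (f' t) t) (h0 : 0 ≤ f 0)
    (h : ∀ t ∈ Ici (0 : ℝ), f t < 0 → 0 ≤ f' t) {t : ℝ} (ht : 0 ≤ t) : 0 ≤ f t := by
  by_contra! hneg
  have hcont : ContinuousOn f (Icc 0 t) := fun s hs =>
    (hf s hs.1).continuousAt.continuousWithinAt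
  have hcpt : IsCompact (Icc 0 t ∩ f ⁻¹' Ici 0) :=
    isCompact_Icc.of_isClosed_subset (hcont.preimage_isClosed_of_isClosed isClosed_Icc isClosed_Ici)
      inter_subset_left
  obtain ⟨s, ⟨⟨hs0, hst⟩, hfs⟩, hmax⟩ :=
    hcpt.exists_isGreatest ⟨0, ⟨le_rfl, ht⟩, h0⟩
  have hlt : ∀ r ∈ Ioc s t, f r < 0 := fun r hr => by
    by_contra! hr0
    exact absurd (hmax ⟨⟨hs0.trans hr.1.le, hr.2⟩, hr0⟩) (not_le.2 hr.1)
  have hmono : MonotoneOn f (Icc s t) := by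
    refine monotoneOn_of_hasDerivWithinAt_nonneg (f' := f') (convex_Icc s t)
      (hcont.mono (Icc_subset_Icc_left hs0)) ?_ ?_ <;> rw [interior_Icc] <;> intro r hr
    · exact (hf r (hs0.trans hr.1.le)).hasDerivWithinAt
    · exact h r (hs0.trans hr.1.le) (hlt r ⟨hr.1, hr.2.le⟩)
  have hle := hmono ⟨le_rfl, hst⟩ ⟨hst, le_rfl⟩ hst
  have hfs' : 0 ≤ f s := hfs
  linarith

/-- A solution of `w' = A (P e^{-uw} - Q e^{vw})` with `w 0 = 0`, `A t ≥ (1 + t)^{-a}` dominates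
the solution of the problem in which the drift of `e^{uw}` is replaced by its chord `P - L e^{uw}`,
where `L = Q e^{v w*}` and `w*` is the equilibrium. -/
lemma le_exp_of_exponential_flow {u v P Q L a ws : ℝ} (hu : 0 < u) (hv : 0 < v) (hQ : 0 < Q)
    (ha : 1 < a) (hws : 0 < ws) (hL : L = Q * exp (v * ws)) (hP : P = L * exp (u * ws))
    {w A : ℝ → ℝ} (hw0 : w 0 = 0)
    (hderiv : ∀ t ∈ Ici (0 : ℝ),
      HasDerivAt w (A t * (P * exp (-u * w t) - Q * exp (v * w t))) t)
    (hA : ∀ t ∈ Ici (0 : ℝ), (1 + t) ^ (-a) ≤ A t) {t : ℝ} (ht : 0 ≤ t) :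
    exp (u * ws) - (exp (u * ws) - 1) * exp (-(u * L) * ((1 - (1 + t) ^ (1 - a)) / (a - 1)))
      ≤ exp (u * w t) := by
  have hLpos : 0 < L := by rw [hL]; positivity
  have hE : 1 < exp (u * ws) := one_lt_exp_iff.2 (mul_pos hu hws)
  set E := exp (u * ws)
  set b : ℝ → ℝ := fun t =>
    E - (E - 1) * exp (-(u * L) * ((1 - (1 + t) ^ (1 - a)) / (a - 1))) with hb
  have hbE : ∀ s, b s < E := fun s =>
    sub_lt_self _ (mul_pos (sub_pos.2 hE) (exp_pos _))
  have hbderiv : ∀ s ∈ Ici (0 : ℝ), HasDerivAt b (u * (1 + s) ^ (-a) * (P - L * b s)) s := by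
    intro s hs
    have hs1 : 0 < 1 + s := by linarith [mem_Ici.1 hs]
    have h1 : HasDerivAt (fun s : ℝ => (1 + s) ^ (1 - a)) (1 * (1 - a) * (1 + s) ^ (1 - a - 1)) s :=
      ((hasDerivAt_id s).const_add 1).rpow_const (Or.inl hs1.ne')
    have h2 := (((((h1.const_sub 1).div_const (a - 1)).const_mul (-(u * L))).exp).const_mul
      (E - 1)).const_sub E
    refine h2.congr_deriv ?_
    have ha1 : a - 1 ≠ 0 := by linarith
    rw [show 1 - a - 1 = -a by ring, hP, hb]
    simp only
    field_simp
    ring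
  have hkey : 0 ≤ exp (u * w t) - b t := by
    refine nonneg_of_deriv_nonneg_of_neg (f := fun s => exp (u * w s) - b s)
      (fun s hs => (((hderiv s hs).const_mul u).exp).sub (hbderiv s hs)) ?_ ?_ ht
    · simp [hb, hw0]
    · intro s hs hneg
      have hzb : exp (u * w s) < b s := by simpa using hneg
      have hs1 : 0 < 1 + s := by linarith [mem_Ici.1 hs]
      have hwlt : w s < ws :=
        lt_of_mul_lt_mul_left (exp_lt_exp.1 (hzb.trans (hbE s))) hu.le
      have hQL : Q * exp (v * w s) ≤ L := by
        rw [hL]; gcongr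
      have hzinv : exp (u * w s) * exp (-u * w s) = 1 := by
        rw [← exp_add]; simp
      have hPb : 0 ≤ P - L * b s := by
        rw [hP, ← mul_sub]; exact mul_nonneg hLpos.le (sub_nonneg.2 (hbE s).le)
      have hdrift : P - L * b s ≤ P - Q * exp (v * w s) * exp (u * w s) := by
        have : Q * exp (v * w s) * exp (u * w s) ≤ L * b s := by gcongr
        linarith
      have hmul : (1 + s) ^ (-a) * (P - L * b s)
          ≤ A s * (P - Q * exp (v * w s) * exp (u * w s)) :=
        mul_le_mul (hA s hs) hdrift hPb ((rpow_pos_of_pos hs1 _).le.trans (hA s hs))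
      have hrw : exp (u * w s) * (u * (A s * (P * exp (-u * w s) - Q * exp (v * w s))))
          = u * (A s * (P - Q * exp (v * w s) * exp (u * w s))) := by
        linear_combination u * A s * P * hzinv
      rw [hrw, mul_assoc u, ← mul_sub]
      exact mul_nonneg hu.le (sub_nonneg.2 hmul)
  exact sub_nonneg.1 hkey

/-- Rational lower bound for the flow of `le_exp_of_exponential_flow` once
`(1 + t)^{1-a} ≤ 1/2`. -/
lemma div_le_exp_of_exponential_flow {u v P Q L K a ws : ℝ} (hu : 0 < u) (hv : 0 < v)
    (hQ : 0 < Q) (ha : 1 < a) (hK : K = 2 * (a - 1)) (hws : 0 < ws)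
    (hL : L = Q * exp (v * ws)) (hP : P = L * exp (u * ws))
    {w A : ℝ → ℝ} (hw0 : w 0 = 0)
    (hderiv : ∀ t ∈ Ici (0 : ℝ),
      HasDerivAt w (A t * (P * exp (-u * w t) - Q * exp (v * w t))) t)
    (hA : ∀ t ∈ Ici (0 : ℝ), (1 + t) ^ (-a) ≤ A t) {t : ℝ} (ht : 0 ≤ t)
    (hhalf : (1 + t) ^ (1 - a) ≤ 1 / 2) :
    (K + u * P) / (K + u * L) ≤ exp (u * w t) := by
  refine le_trans ?_ (le_exp_of_exponential_flow hu hv hQ ha hws hL hP hw0 hderiv hA ht)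
  have hLpos : 0 < L := by rw [hL]; positivity
  have hE : 1 < exp (u * ws) := one_lt_exp_iff.2 (mul_pos hu hws)
  have hKpos : 0 < K := by linarith
  have hτ : 1 / K ≤ (1 - (1 + t) ^ (1 - a)) / (a - 1) := by
    rw [div_le_div_iff₀ hKpos (by linarith), hK]
    nlinarith
  have hexp : exp (-(u * L) * ((1 - (1 + t) ^ (1 - a)) / (a - 1))) ≤ K / (K + u * L) := by
    rw [neg_mul, exp_neg, show K / (K + u * L) = (u * L * (1 / K) + 1)⁻¹ by field_simp; ring]
    gcongr
    exact (add_one_le_exp _).trans (exp_le_exp.2 (by gcongr))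
  have hsub := mul_le_mul_of_nonneg_left hexp (sub_nonneg.2 hE.le)
  have hden : 0 < K + u * L := by positivity
  have heq : (K + u * P) / (K + u * L)
      = exp (u * ws) - (exp (u * ws) - 1) * (K / (K + u * L)) := by
    rw [hP]; field_simp; ring
  linarith

/-- Theorem 1, paper's stated form, for nonnegative `δ·y`.
Under the hypotheses of the deterministic core of Theorem 1, assuming
additionally `δ·y ≥ 0` and setting `ε = δy/(2β)`, `c₁ = K/(β+δy)²`,
`c₂ = K/((β+δy)^(3/2−ε)·(β−δy)^(1/2+ε))`, for every `t ≥ 0` with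
`(1+t)^(1−a) ≤ 1/2` the spurious weight satisfies
`w(t) ≥ (1/(β+δy))·ln((c₁+p)/(c₂ + p^(1/2−ε)·(1−p)^(1/2+ε)))`. -/
theorem theorem1_paper_form (β δ y p a : ℝ)
    (hβ : 0 < β) (hy : y = 1 ∨ y = -1) (hδ : |δ| < β)
    (hp : p ∈ Set.Ioo (1/2 : ℝ) 1) (ha : 1 < a)
    (hδy : 0 ≤ δ * y)
    (u v P Q L K ε c₁ c₂ : ℝ)
    (hu : u = β + δ * y) (hv : v = β - δ * y)
    (hP : P = p * u) (hQ : Q = (1 - p) * v) (hPQ : Q < P)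
    (hL : L = P ^ (v / (u + v)) * Q ^ (u / (u + v)))
    (hK : K = 2 * (a - 1))
    (hε : ε = δ * y / (2 * β))
    (hc₁ : c₁ = K / (β + δ * y) ^ 2)
    (hc₂ : c₂ = K / ((β + δ * y) ^ ((3:ℝ)/2 - ε) * (β - δ * y) ^ ((1:ℝ)/2 + ε)))
    (w A : ℝ → ℝ) (hw0 : w 0 = 0)
    (hderiv : ∀ t ∈ Ici (0 : ℝ),
      HasDerivAt w (A t * (P * Real.exp (-u * w t) - Q * Real.exp (v * w t))) t)
    (hAcont : ContinuousOn A (Ici (0 : ℝ)))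
    (hA : ∀ t ∈ Ici (0 : ℝ), (1 + t) ^ (-a) ≤ A t) :
    ∀ t ∈ Ici (0 : ℝ), (1 + t) ^ (1 - a) ≤ 1/2 →
      (1 / (β + δ * y)) *
        Real.log ((c₁ + p) / (c₂ + p ^ ((1:ℝ)/2 - ε) * (1 - p) ^ ((1:ℝ)/2 + ε)))
        ≤ w t := by
  intro t ht hhalf
  obtain ⟨hp1, hp2⟩ := hp
  have hlt : δ * y < β := by
    rcases hy with rfl | rfl <;> linarith [abs_lt.1 hδ |>.1, abs_lt.1 hδ |>.2]
  rw [← hu] at hc₁ hc₂ ⊢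
  rw [← hv] at hc₂
  have hupos : 0 < u := by linarith
  have hvpos : 0 < v := by linarith
  have hp0 : 0 < p := by linarith
  have hq0 : 0 < 1 - p := by linarith
  have hQpos : 0 < Q := by rw [hQ]; positivity
  have hPpos : 0 < P := hQpos.trans hPQ
  have hKpos : 0 < K := by linarith
  have huv : u + v = 2 * β := by linarith
  have hr : (1 : ℝ) / 2 + ε = u / (u + v) := by
    rw [huv, hε, hu]; field_simp
  have hl : (1 : ℝ) / 2 - ε = v / (u + v) := by
    rw [huv, hε, hv]; field_simp
  have hsum : u / (u + v) + v / (u + v) = 1 := by field_simp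
  have hLexp : L = Q * exp (v * (log (P / Q) / (u + v))) := by
    have hlog : v * (log (P / Q) / (u + v)) = log (P / Q) * (v / (u + v)) := by ring
    rw [hL, hlog, ← rpow_def_of_pos (by positivity), div_rpow hPpos.le hQpos.le,
      show u / (u + v) = 1 - v / (u + v) by linarith, rpow_sub hQpos, rpow_one]
    ring
  have hPexp : P = L * exp (u * (log (P / Q) / (u + v))) := by
    rw [hLexp, mul_assoc, ← exp_add,
      show v * (log (P / Q) / (u + v)) + u * (log (P / Q) / (u + v)) = log (P / Q) by
        field_simp; ring,
      exp_log (by positivity)]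
    field_simp
  have hws : 0 < log (P / Q) / (u + v) :=
    div_pos (log_pos ((one_lt_div hQpos).2 hPQ)) (by linarith)
  have hmain := div_le_exp_of_exponential_flow hupos hvpos hQpos ha hK hws hLexp hPexp hw0 hderiv
    hA ht hhalf
  set G := u ^ ((1 : ℝ) / 2 - ε) * v ^ ((1 : ℝ) / 2 + ε) with hG
  set ℓ := p ^ ((1 : ℝ) / 2 - ε) * (1 - p) ^ ((1 : ℝ) / 2 + ε) with hℓ
  have hGpos : 0 < G := by positivity
  have hℓpos : 0 < ℓ := by positivity
  have hGu : G ≤ u := by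
    calc G ≤ u ^ ((1 : ℝ) / 2 - ε) * u ^ ((1 : ℝ) / 2 + ε) := by
          rw [hG]
          refine mul_le_mul_of_nonneg_left
            (rpow_le_rpow hvpos.le (by linarith) ?_) (rpow_pos_of_pos hupos _).le
          rw [hr]; positivity
      _ = u := by rw [← rpow_add hupos]; ring_nf; exact rpow_one u
  have hLG : L = ℓ * G := by
    rw [hL, ← hr, ← hl, hP, hQ, mul_rpow hp0.le hupos.le, mul_rpow hq0.le hvpos.le]
    ring
  have hc₂' : c₂ = K / (u * G) := by
    rw [hc₂, show (3 : ℝ) / 2 - ε = 1 + (1 / 2 - ε) by ring, rpow_add hupos, rpow_one, mul_assoc]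
  have hbound : (c₁ + p) / (c₂ + ℓ) ≤ exp (u * w t) := by
    refine le_trans ?_ hmain
    have heq : (c₁ + p) / (c₂ + ℓ) = G / u * ((K + u * P) / (K + u * L)) := by
      rw [hc₁, hc₂', hLG, hP]
      field_simp
    rw [heq]
    refine mul_le_of_le_one_left ?_ ((div_le_one hupos).2 hGu)
    have hLpos : 0 < L := by rw [hLG]; positivity
    positivity
  have hpos : 0 < (c₁ + p) / (c₂ + ℓ) := by
    rw [hc₁, hc₂']; positivity
  rw [one_div, inv_mul_le_iff₀ hupos]
  exact (log_le_iff_le_exp hpos).2 hbound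
end

section
/- Let u, v, P, Q be positive reals with P > Q, let D(w) = P·exp(−u·w) − Q·exp(v·w), and set L = P^{v/(u+v)}·Q^{u/(u+v)}. Suppose w : [0,∞) → ℝ is differentiable with w(0) = 0 and w′(t) = A(t)·D(w(t)) for all t ≥ 0, where A is continuous with A(t) > 0. Then for every t ≥ 0: P·exp(−u·w(t)) − L > 0. -/
open Real Set

/-- A solution of the linear equation `z' = c z` on `[0,∞)` that starts positive stays positive. -/
lemma pos_of_hasDerivAt_mul_self {z c : ℝ → ℝ} (hc : ContinuousOn c (Ici 0))
    (hz : ∀ t ∈ Ici (0 : ℝ), HasDerivAt z (c t * z t) t) (hz0 : 0 < z 0) :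
    ∀ t ∈ Ici (0 : ℝ), 0 < z t := by
  intro t ht
  have hC : Continuous fun s => c (max 0 s) :=
    hc.comp_continuous (by fun_prop) fun s => le_max_left 0 s
  set F : ℝ → ℝ := fun s => ∫ x in (0 : ℝ)..s, c (max 0 x)
  have hg : ∀ s ∈ Ici (0 : ℝ), HasDerivAt (fun s => z s * Real.exp (-F s)) 0 s := by
    intro s hs
    have hF : HasDerivAt F (c s) s := by
      simpa [max_eq_right (mem_Ici.mp hs)] using intervalIntegral.integral_hasDerivAt_right (hC.intervalIntegrable 0 s)
        (hC.stronglyMeasurableAtFilter _ _) hC.continuousAt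
    exact ((hz s hs).mul hF.neg.exp).congr_deriv (by simp only [Pi.neg_apply]; ring)
  have hconst := constant_of_has_deriv_right_zero
    (fun s hs => (hg s hs.1).continuousAt.continuousWithinAt)
    (fun s hs => (hg s hs.1).hasDerivWithinAt) t (right_mem_Icc.mpr ht)
  have hpos : 0 < z t * Real.exp (-F t) := by
    rw [hconst]
    positivity
  exact pos_of_mul_pos_left hpos (Real.exp_pos _).le

/-- The weighted geometric mean of `P` and `Q` lies strictly below `P * exp (-u * x)` as soon as
`Q * exp (v * x) < P * exp (-u * x)`. -/
lemma rpow_mul_rpow_lt_mul_exp {u v P Q x : ℝ} (hu : 0 < u) (hv : 0 < v) (hP : 0 < P)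
    (hQ : 0 < Q) (h : Q * Real.exp (v * x) < P * Real.exp (-u * x)) :
    P ^ (v / (u + v)) * Q ^ (u / (u + v)) < P * Real.exp (-u * x) := by
  have huv : 0 < u + v := add_pos hu hv
  set a := P * Real.exp (-u * x) with ha
  set b := Q * Real.exp (v * x) with hb
  have ha0 : 0 < a := by positivity
  have hb0 : 0 < b := by positivity
  calc P ^ (v / (u + v)) * Q ^ (u / (u + v))
      = a ^ (v / (u + v)) * b ^ (u / (u + v)) := by
        rw [ha, hb, Real.mul_rpow hP.le (Real.exp_pos _).le,
          Real.mul_rpow hQ.le (Real.exp_pos _).le, ← Real.exp_mul, ← Real.exp_mul,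
          mul_mul_mul_comm, ← Real.exp_add]
        have : -u * x * (v / (u + v)) + v * x * (u / (u + v)) = 0 := by ring
        rw [this, Real.exp_zero, mul_one]
    _ < a ^ (v / (u + v)) * a ^ (u / (u + v)) := by
        gcongr
    _ = a := by
        rw [← Real.rpow_add ha0, ← add_div, add_comm v u, div_self huv.ne', Real.rpow_one]

/-- For positive reals `u, v, P, Q` with `P > Q`, drift
`D w = P·exp(−u·w) − Q·exp(v·w)` and `L = P^(v/(u+v))·Q^(u/(u+v))`, any
trajectory `w` with `w 0 = 0` and `w′(t) = A(t)·D(w(t))` for a continuous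
positive `A` on `[0,∞)` satisfies `P·exp(−u·w(t)) − L > 0` for all `t ≥ 0`. -/
theorem trajectory_denominator_positive (u v P Q : ℝ)
    (hu : 0 < u) (hv : 0 < v) (hP : 0 < P) (hQ : 0 < Q) (hPQ : Q < P)
    (D : ℝ → ℝ)
    (hD : ∀ x, D x = P * Real.exp (-u * x) - Q * Real.exp (v * x))
    (L : ℝ) (hL : L = P ^ (v / (u + v)) * Q ^ (u / (u + v)))
    (w A : ℝ → ℝ) (hw0 : w 0 = 0)
    (hderiv : ∀ t ∈ Ici (0 : ℝ), HasDerivAt w (A t * D (w t)) t)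
    (hAcont : ContinuousOn A (Ici (0 : ℝ)))
    (hApos : ∀ t ∈ Ici (0 : ℝ), 0 < A t) :
    ∀ t ∈ Ici (0 : ℝ), 0 < P * Real.exp (-u * w t) - L := by
  intro t ht
  subst hL
  have hD' : ∀ x, HasDerivAt D (-(u * P * Real.exp (-u * x) + v * Q * Real.exp (v * x))) x := by
    intro x
    rw [funext hD]
    exact ((((hasDerivAt_id x).const_mul (-u)).exp.const_mul P).sub
      (((hasDerivAt_id x).const_mul v).exp.const_mul Q)).congr_deriv (by simp only [id]; ring)
  have hw : ContinuousOn w (Ici 0) := fun s hs => (hderiv s hs).continuousAt.continuousWithinAt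
  have hpos : 0 < D (w t) := by
    refine pos_of_hasDerivAt_mul_self (z := fun s => D (w s)) (c := fun s =>
      -(u * P * Real.exp (-u * w s) + v * Q * Real.exp (v * w s)) * A s)
      (by fun_prop) (fun s hs => ?_) (by simpa [hD, hw0] using hPQ) t ht
    exact ((hD' (w s)).comp s (hderiv s hs)).congr_deriv (by ring)
  rw [hD] at hpos
  exact sub_pos.mpr (rpow_mul_rpow_lt_mul_exp hu hv hP hQ (sub_pos.mp hpos))
end
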